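/- Let G be a uniformly random DAG on n labeled vertices, and condition on its tower σ(G) being equal to a fixed tower σ. Then the edges of G between any two non-adjacent layers (layers H_i and H_j with j > i+1) occur independently, each with probability 1/2. -/

import Mathlib

namespace CausalMEC

/-- A directed graph on `Fin n`, given by a Boolean edge function (`d a b = true` means `a → b`). -/
abbrev Dir (n : ℕ) := Fin n → Fin n → Bool

/-- Directed reachability (zero or more steps). -/
def Reach {n : ℕ} (d : Dir n) : Fin n → Fin n → Prop :=
  Relation.ReflTransGen fun a b => d a b = true

/-- No directed cycles (including no self-loops). -/
def Acyclic {n : ℕ} (d : Dir n) : Prop :=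
  ∀ v, ¬ Relation.TransGen (fun a b => d a b = true) v v

/-- A directed acyclic graph. -/
def IsDAG {n : ℕ} (d : Dir n) : Prop :=
  (∀ v, d v v = false) ∧ Acyclic d

/-- A directed (possibly cyclic) graph with edges between distinct vertices. -/
def IsDCG {n : ℕ} (d : Dir n) : Prop :=
  ∀ v, d v v = false

/-- The number of directed edges. -/
def edgeCount {n : ℕ} (d : Dir n) : ℕ :=
  (Finset.univ.filter fun q : Fin n × Fin n => d q.1 q.2 = true).card

/-- The parent set of a vertex. -/
def parents {n : ℕ} (d : Dir n) (v : Fin n) : Finset (Fin n) :=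
  Finset.univ.filter fun u => d u v = true

/-! ### Paths, d-connection and Markov equivalence in mixed graphs
A mixed graph is given by a directed part `d` and a bidirected part `b`. -/

/-- The kind of a step on a path: a directed edge traversed forwards, a directed edge
traversed backwards, or a bidirected edge. -/
inductive EdgeKind : Type
  | fwd | bwd | bidir
deriving DecidableEq

/-- Does the step point into its second endpoint? -/
def EdgeKind.intoSnd : EdgeKind → Bool
  | .fwd => true
  | .bwd => false
  | .bidir => true

/-- Does the step point into its first endpoint? -/
def EdgeKind.intoFst : EdgeKind → Bool
  | .fwd => false
  | .bwd => true
  | .bidir => true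

/-- A (possibly self-intersecting) path from `u` to `v` in the mixed graph `(d, b)`. -/
structure MPath {n : ℕ} (d b : Dir n) (u v : Fin n) where
  len : ℕ
  vert : Fin (len + 1) → Fin n
  kind : Fin len → EdgeKind
  first_eq : vert 0 = u
  last_eq : vert (Fin.last len) = v
  valid : ∀ i : Fin len,
    (kind i = .fwd → d (vert i.castSucc) (vert i.succ) = true) ∧
    (kind i = .bwd → d (vert i.succ) (vert i.castSucc) = true) ∧
    (kind i = .bidir → b (vert i.castSucc) (vert i.succ) = true)

/-- Whether the internal vertex at position `i` of a path is a collider. -/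
def MPath.colliderAt {n : ℕ} {d b : Dir n} {u v : Fin n} (π : MPath d b u v)
    (i : ℕ) (h1 : 0 < i) (h2 : i < π.len) : Bool :=
  (π.kind ⟨i - 1, by omega⟩).intoSnd && (π.kind ⟨i, h2⟩).intoFst

/-- A path is active given a conditioning set `Z` if every non-collider on it avoids `Z`
and every collider on it is in `Z` or has a descendant in `Z`. -/
def MPath.Active {n : ℕ} {d b : Dir n} {u v : Fin n} (π : MPath d b u v)
    (Z : Finset (Fin n)) : Prop :=
  ∀ (i : ℕ) (h1 : 0 < i) (h2 : i < π.len),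
    (π.colliderAt i h1 h2 = true →
      ∃ x ∈ Z, Reach d (π.vert ⟨i, by omega⟩) x) ∧
    (π.colliderAt i h1 h2 = false →
      π.vert ⟨i, by omega⟩ ∉ Z)

/-- d-connection given a conditioning set. -/
def DConn {n : ℕ} (d b : Dir n) (u v : Fin n) (Z : Finset (Fin n)) : Prop :=
  ∃ π : MPath d b u v, π.Active Z

/-- Markov equivalence of two mixed graphs: the same d-connection relations. -/
def MarkovEquiv {n : ℕ} (d b d' b' : Dir n) : Prop :=
  ∀ (u v : Fin n) (Z : Finset (Fin n)), u ≠ v → u ∉ Z → v ∉ Z →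
    (DConn d b u v Z ↔ DConn d' b' u v Z)

/-- The empty bidirected part: a purely directed graph. -/
def noBi (n : ℕ) : Dir n := fun _ _ => false

/-- Markov equivalence for purely directed graphs. -/
def MarkovEquivD {n : ℕ} (d d' : Dir n) : Prop :=
  MarkovEquiv d (noBi n) d' (noBi n)

/-- The Markov equivalence class of a DAG (within DAGs). -/
def MECdag {n : ℕ} (d : Dir n) : Set (Dir n) :=
  {d' | IsDAG d' ∧ MarkovEquivD d d'}

/-- An acyclic directed mixed graph. -/
def IsADMG {n : ℕ} (d b : Dir n) : Prop :=
  IsDAG d ∧ (∀ v w, b v w = b w v) ∧ (∀ v, b v v = false)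

/-- The Markov equivalence class of an ADMG (within ADMGs). -/
def MECadmg {n : ℕ} (d b : Dir n) : Set (Dir n × Dir n) :=
  {G | IsADMG G.1 G.2 ∧ MarkovEquiv d b G.1 G.2}

/-- The Markov equivalence class of a DCG (within DCGs). -/
def MECdcg {n : ℕ} (d : Dir n) : Set (Dir n) :=
  {d' | IsDCG d' ∧ MarkovEquivD d d'}

/-! ### The distribution `D(n,p)` and uniform ADMGs/DCGs -/

/-- The (unnormalized) weight of a DAG under `D(n,p)`. -/
noncomputable def dagWeight {n : ℕ} (p : ℝ) (d : Dir n) : ℝ :=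
  (p / (1 - p)) ^ edgeCount d

open scoped Classical in
/-- Probability of the event `A` under `D(n,p)`. -/
noncomputable def prD (n : ℕ) (p : ℝ) (A : Dir n → Prop) : ℝ :=
  (∑ d : Dir n, if IsDAG d ∧ A d then dagWeight p d else 0) /
    (∑ d : Dir n, if IsDAG d then dagWeight p d else 0)

open scoped Classical in
/-- Expectation of `f` under `D(n,p)`. -/
noncomputable def expD (n : ℕ) (p : ℝ) (f : Dir n → ℝ) : ℝ :=
  (∑ d : Dir n, if IsDAG d then f d * dagWeight p d else 0) /
    (∑ d : Dir n, if IsDAG d then dagWeight p d else 0)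

/-- Conditional probability of `A` given `B` under `D(n,p)`. -/
noncomputable def condPrD (n : ℕ) (p : ℝ) (A B : Dir n → Prop) : ℝ :=
  prD n p (fun d => A d ∧ B d) / prD n p B

open scoped Classical in
/-- Expectation of `f` under the uniform distribution on ADMGs on `n` vertices. -/
noncomputable def expADMG (n : ℕ) (f : Dir n × Dir n → ℝ) : ℝ :=
  (∑ G : Dir n × Dir n, if IsADMG G.1 G.2 then f G else 0) /
    (∑ G : Dir n × Dir n, if IsADMG G.1 G.2 then (1 : ℝ) else 0)

open scoped Classical in
/-- Expectation of `f` under the uniform distribution on DCGs on `n` vertices. -/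
noncomputable def expDCG (n : ℕ) (f : Dir n → ℝ) : ℝ :=
  (∑ d : Dir n, if IsDCG d then f d else 0) /
    (∑ d : Dir n, if IsDCG d then (1 : ℝ) else 0)

open scoped Classical in
/-- Probability of the event `A` under the uniform distribution on DCGs on `n` vertices. -/
noncomputable def prDCG (n : ℕ) (A : Dir n → Prop) : ℝ :=
  (∑ d : Dir n, if IsDCG d ∧ A d then (1 : ℝ) else 0) /
    (∑ d : Dir n, if IsDCG d then (1 : ℝ) else 0)

/-! ### Tower decomposition -/

/-- The sources of `d` within a vertex set `S` (no parents inside `S`). -/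
def sourcesIn {n : ℕ} (d : Dir n) (S : Finset (Fin n)) : Finset (Fin n) :=
  S.filter fun v => ∀ u ∈ S, d u v = false

/-- The vertices remaining after peeling off `k` layers of sources. -/
def remaining {n : ℕ} (d : Dir n) : ℕ → Finset (Fin n)
  | 0 => Finset.univ
  | k + 1 => remaining d k \ sourcesIn d (remaining d k)

/-- The `i`-th layer (1-based) of the tower decomposition of `d`. -/
def towerLayer {n : ℕ} (d : Dir n) (i : ℕ) : Finset (Fin n) :=
  sourcesIn d (remaining d (i - 1))

/-- The 1-based index of the layer containing `v`. -/
def layerIdx {n : ℕ} (d : Dir n) (v : Fin n) : ℕ :=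
  ((Finset.range n).filter fun j => v ∈ remaining d j).card

/-- The tower of a DAG: only the edges between adjacent layers are kept. -/
def tower {n : ℕ} (d : Dir n) : Dir n :=
  fun a c => d a c && decide (layerIdx d c = layerIdx d a + 1)

/-- `h` is the tower vector of `d` (layer sizes, 1-based, and no further layers). -/
def hasTowerVector {n : ℕ} (d : Dir n) (h : List ℕ) : Prop :=
  (∀ i : Fin h.length, (towerLayer d (i.val + 1)).card = h.get i) ∧
    towerLayer d (h.length + 1) = ∅

/-- `H` is the tower decomposition of `d`. -/
def hasTowerDecomp {n : ℕ} (d : Dir n) (H : List (Finset (Fin n))) : Prop :=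
  (∀ i : Fin H.length, towerLayer d (i.val + 1) = H.get i) ∧
    towerLayer d (H.length + 1) = ∅

/-- The weight `w(h)` of a tower vector `h = (h_1, …, h_s)`. -/
noncomputable def towerWeight (p : ℝ) (h : List ℕ) : ℝ :=
  (Nat.multinomial Finset.univ (fun i : Fin h.length => h.get i) : ℝ) *
    ∏ k ∈ Finset.Icc 2 h.length,
      (1 - (1 - p) ^ h.getD (k - 2) 0) ^ h.getD (k - 1) 0 /
        (1 - p) ^ (h.getD (k - 1) 0 * ∑ i ∈ Finset.range (k - 1), h.getD i 0)

/-! ### Edge reversal and deletion -/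

/-- Reverse the edge `v → w`. -/
def reverseEdge {n : ℕ} (d : Dir n) (v w : Fin n) : Dir n :=
  fun a c => if a = v ∧ c = w then false else if a = w ∧ c = v then true else d a c

/-- Delete the edge `v → w`. -/
def deleteEdge {n : ℕ} (d : Dir n) (v w : Fin n) : Dir n :=
  fun a c => if a = v ∧ c = w then false else d a c

/-- The edge `v → w` of a DAG is reversible: reversing it yields a Markov-equivalent DAG. -/
def Reversible {n : ℕ} (d : Dir n) (v w : Fin n) : Prop :=
  d v w = true ∧ IsDAG (reverseEdge d v w) ∧ MarkovEquivD d (reverseEdge d v w)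

/-- `d` has a matching of reversible layer-2-edges of size at least `m`. -/
def hasRevL2Matching {n : ℕ} (d : Dir n) (m : ℝ) : Prop :=
  ∃ S : Finset (Fin n × Fin n),
    (∀ e ∈ S, Reversible d e.1 e.2 ∧ e.2 ∈ towerLayer d 2) ∧
    (∀ e ∈ S, ∀ e' ∈ S, e ≠ e' →
      e.1 ≠ e'.1 ∧ e.1 ≠ e'.2 ∧ e.2 ≠ e'.1 ∧ e.2 ≠ e'.2) ∧
    m ≤ (S.card : ℝ)

/-! ### Cycles and the `Reverse` construction -/

/-- Cyclic successor in `Fin k`. -/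
def cycSucc {k : ℕ} (i : Fin k) : Fin k :=
  ⟨(i.val + 1) % k, Nat.mod_lt _ i.pos⟩

/-- The reversed parametrization of a cycle. -/
def cycRev {n k : ℕ} (c : Fin k → Fin n) : Fin k → Fin n :=
  fun i => c ⟨(k - i.val) % k, Nat.mod_lt _ i.pos⟩

/-- `c` lists the (distinct) vertices of a directed cycle of `d`, in order. -/
def IsCycle {n k : ℕ} (d : Dir n) (c : Fin k → Fin n) : Prop :=
  Function.Injective c ∧ ∀ i, d (c i) (c (cycSucc i)) = true

/-- The `Reverse(G, C)` construction: reverse the cycle `c` and redirect every edge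
`w → v_i` with `w ∈ Pa(v_i) \ {v_{i-1}}` to `w → v_{i-1}`. -/
def reverseCycle {n k : ℕ} (d : Dir n) (c : Fin k → Fin n) : Dir n :=
  fun a e =>
    decide ((∃ j : Fin k, e = c j ∧
        (a = c (cycSucc j) ∨ (d a (c (cycSucc j)) = true ∧ a ≠ c j))) ∨
      ((∀ j : Fin k, e ≠ c j) ∧ d a e = true))

/-- A vertex triple induces exactly a directed 3-cycle. -/
def induces3Cycle {n : ℕ} (d : Dir n) (W : Finset (Fin n)) : Prop :=
  ∃ a b c : Fin n, W = {a, b, c} ∧ a ≠ b ∧ a ≠ c ∧ b ≠ c ∧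
    d a b = true ∧ d b c = true ∧ d c a = true ∧
    d b a = false ∧ d c b = false ∧ d a c = false

/-- `L` assigns to each vertex the 1-based index of its layer in the tower decomposition:
edges go strictly upwards, and every vertex above the first layer has a parent in the layer
just below. -/
structure IsLayering {n : ℕ} (d : Dir n) (L : Fin n → ℕ) : Prop where
  pos : ∀ v, 0 < L v
  lt_of_edge : ∀ u v, d u v = true → L u < L v
  exists_parent : ∀ v, 1 < L v → ∃ u, d u v = true ∧ L v = L u + 1

theorem mem_remaining_succ {n : ℕ} (d : Dir n) (k : ℕ) (v : Fin n) :
    v ∈ remaining d (k + 1) ↔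
      v ∈ remaining d k ∧ ∃ u ∈ remaining d k, d u v = true := by
  simp only [remaining, sourcesIn, Finset.mem_sdiff, Finset.mem_filter, not_and, not_forall,
    Bool.not_eq_false]
  constructor
  · rintro ⟨h, h'⟩
    obtain ⟨u, hu, e⟩ := h' h
    exact ⟨h, u, hu, e⟩
  · rintro ⟨h, u, hu, e⟩
    exact ⟨h, fun _ => ⟨u, hu, e⟩⟩

theorem remaining_antitone {n : ℕ} (d : Dir n) : Antitone (remaining d) :=
  antitone_nat_of_succ_le fun k v hv => ((mem_remaining_succ d k v).1 hv).1

theorem IsLayering.mem_remaining {n : ℕ} {d : Dir n} {L : Fin n → ℕ} (h : IsLayering d L)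
    (k : ℕ) (v : Fin n) : v ∈ remaining d k ↔ k < L v := by
  induction k generalizing v with
  | zero => simp [remaining, h.pos v]
  | succ k ih =>
    rw [mem_remaining_succ, ih]
    constructor
    · rintro ⟨_, u, hu, e⟩
      have := (ih u).1 hu
      have := h.lt_of_edge u v e
      omega
    · intro hk
      obtain ⟨u, e, hu⟩ := h.exists_parent v (by omega)
      exact ⟨by omega, u, (ih u).2 (by omega), e⟩

theorem layerIdx_le {n : ℕ} (d : Dir n) (v : Fin n) : layerIdx d v ≤ n :=
  (Finset.card_filter_le _ _).trans_eq (Finset.card_range n)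

theorem IsLayering.layerIdx_eq {n : ℕ} {d : Dir n} {L : Fin n → ℕ} (h : IsLayering d L)
    (hn : ∀ v, L v ≤ n) : layerIdx d = L := by
  funext v
  have : (Finset.range n).filter (fun j => v ∈ remaining d j) = Finset.range (L v) := by
    ext j
    have := hn v
    simp only [Finset.mem_filter, Finset.mem_range, h.mem_remaining]
    omega
  rw [layerIdx, this, Finset.card_range]

theorem IsLayering.isDAG {n : ℕ} {d : Dir n} {L : Fin n → ℕ} (h : IsLayering d L) :
    IsDAG d := by
  have key : ∀ u v, Relation.TransGen (fun a b => d a b = true) u v → L u < L v := by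
    intro u v huv
    induction huv with
    | single e => exact h.lt_of_edge _ _ e
    | tail _ e ih => exact ih.trans (h.lt_of_edge _ _ e)
  refine ⟨fun v => ?_, fun v hv => lt_irrefl _ (key v v hv)⟩
  by_contra hv
  exact lt_irrefl _ (h.lt_of_edge v v (by simpa using hv))

/-- In an acyclic graph every nonempty vertex set has a source. -/
theorem Acyclic.exists_source {n : ℕ} {d : Dir n} (h : Acyclic d) {S : Finset (Fin n)}
    (hS : S.Nonempty) : ∃ v ∈ S, ∀ u ∈ S, d u v = false := by
  let r : Fin n → Fin n → Prop := Relation.TransGen fun a b => d a b = true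
  have : Std.Irrefl r := ⟨h⟩
  have : IsTrans (Fin n) r := ⟨fun _ _ _ => Relation.TransGen.trans⟩
  obtain ⟨v, hv, hmin⟩ := (Finite.wellFounded_of_trans_of_irrefl r).has_min (S : Set (Fin n)) hS
  refine ⟨v, hv, fun u hu => ?_⟩
  by_contra e
  exact hmin u hu (.single (by simpa using e))

theorem Acyclic.card_remaining_add_le {n : ℕ} {d : Dir n} (h : Acyclic d) (k : ℕ)
    (hk : (remaining d k).Nonempty) : (remaining d k).card + k ≤ n := by
  induction k with
  | zero => simp [remaining]
  | succ k ih =>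
    have hne : (remaining d k).Nonempty := hk.mono (remaining_antitone d k.le_succ)
    obtain ⟨v, hv, hsrc⟩ := h.exists_source hne
    have hlt : (remaining d (k + 1)).card < (remaining d k).card := by
      refine Finset.card_lt_card ⟨remaining_antitone d k.le_succ, fun hsub => ?_⟩
      obtain ⟨_, u, hu, e⟩ := (mem_remaining_succ d k v).1 (hsub hv)
      simp [hsrc u hu] at e
    have := ih hne
    omega

theorem Acyclic.mem_remaining_iff {n : ℕ} {d : Dir n} (h : Acyclic d) (k : ℕ) (v : Fin n) :
    v ∈ remaining d k ↔ k < layerIdx d v := by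
  constructor
  · intro hv
    have hkn := h.card_remaining_add_le k ⟨v, hv⟩
    have := Finset.card_pos.2 ⟨v, hv⟩
    have hsub : Finset.range (k + 1) ⊆
        (Finset.range n).filter fun j => v ∈ remaining d j := by
      intro j hj
      rw [Finset.mem_range] at hj
      exact Finset.mem_filter.2 ⟨Finset.mem_range.2 (by omega),
        remaining_antitone d (by omega) hv⟩
    simpa [layerIdx] using Finset.card_le_card hsub
  · intro hk
    by_contra hv
    have hsub : ((Finset.range n).filter fun j => v ∈ remaining d j) ⊆ Finset.range k := by
      intro j hj
      rw [Finset.mem_range]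
      by_contra hjk
      exact hv (remaining_antitone d (by omega) (Finset.mem_filter.1 hj).2)
    have := Finset.card_le_card hsub
    rw [Finset.card_range] at this
    exact absurd hk (not_lt.2 this)

theorem Acyclic.isLayering {n : ℕ} {d : Dir n} (h : Acyclic d) :
    IsLayering d (layerIdx d) := by
  have pos : ∀ v, 0 < layerIdx d v := fun v =>
    (h.mem_remaining_iff 0 v).1 (Finset.mem_univ v)
  have mono : ∀ u v, d u v = true → layerIdx d u < layerIdx d v := by
    intro u v e
    by_contra hle
    have hv := pos v
    have hv' := (h.mem_remaining_iff (layerIdx d v - 1 + 1) v).1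
      ((mem_remaining_succ d _ v).2 ⟨(h.mem_remaining_iff _ v).2 (by omega), u,
        (h.mem_remaining_iff _ u).2 (by omega), e⟩)
    omega
  refine ⟨pos, mono, fun v hv => ?_⟩
  obtain ⟨_, u, hu, e⟩ := (mem_remaining_succ d (layerIdx d v - 2) v).1
    ((h.mem_remaining_iff _ v).2 (by omega))
  have := (h.mem_remaining_iff _ u).1 hu
  have := mono u v e
  exact ⟨u, e, by omega⟩

theorem IsLayering.tower {n : ℕ} {d : Dir n} (h : IsLayering d (layerIdx d)) :
    IsLayering (tower d) (layerIdx d) where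
  pos := h.pos
  lt_of_edge u v e := by
    simp only [CausalMEC.tower, Bool.and_eq_true] at e
    exact h.lt_of_edge u v e.1
  exists_parent v hv := by
    obtain ⟨u, e, hu⟩ := h.exists_parent v hv
    exact ⟨u, by simp [CausalMEC.tower, e, hu], hu⟩

/-- A DAG and its tower have the same layers. -/
theorem Acyclic.layerIdx_tower {n : ℕ} {d : Dir n} (h : Acyclic d) :
    layerIdx (tower d) = layerIdx d :=
  h.isLayering.tower.layerIdx_eq (layerIdx_le d)

/-- The DAGs with a given tower are obtained by choosing the edges between non-adjacent layers
arbitrarily. -/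
theorem isDAG_and_tower_eq_iff {n : ℕ} {d₀ : Dir n} (h₀ : IsDAG d₀) (d : Dir n) :
    (IsDAG d ∧ tower d = tower d₀) ↔
      ∀ a c, ¬ layerIdx (tower d₀) a + 1 < layerIdx (tower d₀) c → d a c = tower d₀ a c := by
  have hL := h₀.2.isLayering
  have hT := hL.tower
  constructor
  · rintro ⟨hd, e⟩ a c hac
    rw [← e, hd.2.layerIdx_tower] at hac
    rw [← e]
    by_cases hadj : layerIdx d c = layerIdx d a + 1
    · simp [tower, hadj]
    · simp only [tower, hadj, decide_false, Bool.and_false]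
      by_contra hne
      have := hd.2.isLayering.lt_of_edge a c (by simpa using hne)
      omega
  · intro h
    rw [h₀.2.layerIdx_tower] at h
    have hd : IsLayering d (layerIdx d₀) := by
      refine ⟨hL.pos, fun u v e => ?_, fun v hv => ?_⟩
      · by_cases huv : layerIdx d₀ u + 1 < layerIdx d₀ v
        · omega
        · rw [h u v huv] at e
          exact hT.lt_of_edge u v e
      · obtain ⟨u, e, hu⟩ := hT.exists_parent v hv
        exact ⟨u, by rw [h u v (by omega), e], hu⟩
    refine ⟨hd.isDAG, ?_⟩
    have hidx := hd.layerIdx_eq (layerIdx_le d₀)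
    funext a c
    by_cases hadj : layerIdx d₀ c = layerIdx d₀ a + 1
    · have := h a c (by omega)
      simpa [tower, hidx, hadj] using this
    · simp [tower, hidx, hadj]

/-- Flip the status of the edge `q`. -/
def toggleEdge {n : ℕ} (q : Fin n × Fin n) (d : Dir n) : Dir n :=
  fun a c => if (a, c) = q then !d a c else d a c

theorem toggleEdge_involutive {n : ℕ} (q : Fin n × Fin n) :
    Function.Involutive (toggleEdge q) := by
  intro d
  funext a c
  by_cases h : (a, c) = q <;> simp [toggleEdge, h]

/-- If membership in `S` does not depend on the edges in `F`, then prescribing these edges divides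
the number of graphs by `2 ^ F.card`. -/
theorem card_filter_prescribed_mul_two_pow {n : ℕ} (S : Dir n → Prop)
    [DecidablePred S] (F : Finset (Fin n × Fin n))
    (hS : ∀ q ∈ F, ∀ d, S (toggleEdge q d) ↔ S d) (ε : Fin n × Fin n → Bool) :
    (Finset.univ.filter fun d : Dir n => S d ∧ ∀ q ∈ F, d q.1 q.2 = ε q).card * 2 ^ F.card =
      (Finset.univ.filter S).card := by
  induction F using Finset.induction_on with
  | empty => simp
  | insert q F hq ih =>
    rw [← ih fun p hp => hS p (Finset.mem_insert_of_mem hp), Finset.card_insert_of_notMem hq,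
      pow_succ', ← mul_assoc]
    congr 1
    rw [← Finset.card_filter_add_card_filter_not (s := Finset.univ.filter
      fun d : Dir n => S d ∧ ∀ q ∈ F, d q.1 q.2 = ε q) (fun d => d q.1 q.2 = ε q),
      Finset.filter_filter, Finset.filter_filter, mul_two]
    have toggle_iff : ∀ d : Dir n, (∀ p ∈ F, toggleEdge q d p.1 p.2 = ε p) ↔
        ∀ p ∈ F, d p.1 p.2 = ε p := by
      refine fun d => forall₂_congr fun p hp => ?_
      have : p ≠ q := fun e => hq (e ▸ hp)
      simp [toggleEdge, this]
    congr 1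
    · congr 1
      ext d
      simp only [Finset.mem_filter, Finset.forall_mem_insert]
      tauto
    · refine Finset.card_equiv (toggleEdge_involutive q).toPerm fun d => ?_
      simp only [Finset.mem_filter, Finset.mem_univ, true_and, Finset.forall_mem_insert,
        Function.Involutive.coe_toPerm, toggle_iff, hS q (Finset.mem_insert_self q F)]
      have : toggleEdge q d q.1 q.2 = !d q.1 q.2 := by simp [toggleEdge]
      rw [this]
      cases d q.1 q.2 <;> cases ε q <;> simp

/-- `D(n, 1/2)` is the uniform distribution on DAGs. -/
theorem prD_half (n : ℕ) (A : Dir n → Prop) [DecidablePred (IsDAG (n := n))] [DecidablePred A] :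
    prD n (1 / 2) A = ((Finset.univ.filter fun d : Dir n => IsDAG d ∧ A d).card : ℝ) /
      (Finset.univ.filter fun d : Dir n => IsDAG d).card := by
  have hw : ∀ d : Dir n, dagWeight (1 / 2) d = 1 := fun d => by
    rw [dagWeight]
    norm_num
  simp only [prD, hw, Finset.sum_boole]

/-- Lemma 2.4: for a uniformly random DAG (i.e. `D(n, 1/2)`) conditioned on
its tower being `σ`, the edges between non-adjacent layers occur independently with
probability `1/2` each. -/
theorem tower_conditioning_independence (n : ℕ) (σ : Dir n)
    (hσ : 0 < prD n (1 / 2) fun d => tower d = σ)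
    (F : Finset (Fin n × Fin n))
    (hF : ∀ q ∈ F, layerIdx σ q.1 + 1 < layerIdx σ q.2)
    (ε : Fin n × Fin n → Bool) :
    condPrD n (1 / 2) (fun d => ∀ q ∈ F, d q.1 q.2 = ε q) (fun d => tower d = σ) =
      (1 / 2 : ℝ) ^ F.card := by
  classical
  simp only [condPrD, prD_half] at hσ ⊢
  set N := (Finset.univ.filter fun d : Dir n => IsDAG d).card
  have hN : (N : ℝ) ≠ 0 := fun h => by simp [h] at hσ
  set B := (Finset.univ.filter fun d : Dir n => IsDAG d ∧ tower d = σ).card with hBdef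
  have hB : (B : ℝ) ≠ 0 := fun h => by simp [h] at hσ
  obtain ⟨d₀, hd₀⟩ := Finset.card_pos.1 (Nat.pos_of_ne_zero (Nat.cast_ne_zero.1 hB))
  obtain ⟨h₀, rfl⟩ : IsDAG d₀ ∧ tower d₀ = σ := by simpa using hd₀
  have hcard := card_filter_prescribed_mul_two_pow
    (fun d : Dir n => IsDAG d ∧ tower d = tower d₀) F (fun q hq d => by
      simp only [isDAG_and_tower_eq_iff h₀]
      refine forall₂_congr fun a c => imp_congr_right fun hac => ?_
      have : (a, c) ≠ q := fun e => hac (by subst e; exact hF _ hq)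
      simp [toggleEdge, this]) ε
  have hfilter : (Finset.univ.filter fun d : Dir n =>
      IsDAG d ∧ (∀ q ∈ F, d q.1 q.2 = ε q) ∧ tower d = tower d₀) =
      Finset.univ.filter fun d : Dir n =>
        (IsDAG d ∧ tower d = tower d₀) ∧ ∀ q ∈ F, d q.1 q.2 = ε q := by
    ext d
    simp only [Finset.mem_filter]
    tauto
  rw [hfilter, div_div_div_cancel_right₀ hN, div_eq_iff hB, hBdef, ← hcard]
  push_cast
  rw [mul_left_comm, ← mul_pow]
  norm_num

end CausalMEC
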